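/- The convergent series ∑_{k=1}^∞ 1/(k³·2^k·C(3k,k)) equals −33·ζ(3)/16 + π·G + (log 2)³/6 − π²·(log 2)/24, where ζ(3) = ∑_{n=1}^∞ 1/n³ and G is Catalan's constant. -/

import Mathlib

open scoped BigOperators

/-- Catalan's constant `G = ∑_{n=0}^∞ (-1)^n/(2n+1)²`. -/
noncomputable def catalanG : ℝ := ∑' n : ℕ, (-1) ^ n / (2 * n + 1 : ℝ) ^ 2

/-- `ζ(3) = ∑_{n=1}^∞ 1/n³`. -/
noncomputable def zeta3 : ℝ := ∑' n : ℕ, 1 / (n + 1 : ℝ) ^ 3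

section Auxiliary

open Complex Filter Topology Set MeasureTheory

/-- The power series `∑ c n z^(n+1)`. -/
noncomputable def psum (c : ℕ → ℂ) (z : ℂ) : ℂ := ∑' n, c n * z ^ (n + 1)

lemma norm_mul_pow_le (c : ℂ) {z : ℂ} (hz : ‖z‖ ≤ 1) (n : ℕ) : ‖c * z ^ n‖ ≤ ‖c‖ := by
  rw [norm_mul, norm_pow]
  exact mul_le_of_le_one_right (norm_nonneg _) (pow_le_one₀ (norm_nonneg _) hz)

lemma summable_psum {c : ℕ → ℂ} (hc : Summable fun n => ‖c n‖) {z : ℂ} (hz : ‖z‖ ≤ 1) :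
    Summable fun n => c n * z ^ (n + 1) :=
  .of_norm_bounded hc fun _ => norm_mul_pow_le _ hz _

lemma continuousOn_psum {c : ℕ → ℂ} (hc : Summable fun n => ‖c n‖) :
    ContinuousOn (psum c) (Metric.closedBall 0 1) :=
  continuousOn_tsum (fun n => by fun_prop) hc fun n z hz =>
    norm_mul_pow_le _ (by simpa using hz) _

lemma psum_zero (c : ℕ → ℂ) : psum c 0 = 0 := by simp [psum]

lemma summable_succ_mul_pow {r : ℝ} (h0 : 0 ≤ r) (h1 : r < 1) :
    Summable fun n : ℕ => ((n : ℝ) + 1) * r ^ n := by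
  have h := (summable_pow_mul_geometric_of_norm_lt_one (R := ℝ) 1
    (r := r) (by rwa [Real.norm_of_nonneg h0])).add (summable_geometric_of_lt_one h0 h1)
  exact h.congr fun n => by ring

lemma summable_mul_pow_of_norm_le_succ {d : ℕ → ℂ} (hd : ∀ n : ℕ, ‖d n‖ ≤ n + 1) {z : ℂ}
    (hz : ‖z‖ < 1) : Summable fun n => d n * z ^ n := by
  refine .of_norm_bounded (summable_succ_mul_pow (norm_nonneg z) hz) fun n => ?_
  rw [norm_mul, norm_pow]
  exact mul_le_mul_of_nonneg_right (hd n) (by positivity)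

lemma hasDerivAt_psum {d : ℕ → ℂ} (hd : ∀ n : ℕ, ‖d n‖ ≤ n + 1) {z : ℂ} (hz : ‖z‖ < 1) :
    HasDerivAt (psum fun n => d n / (n + 1)) (∑' n, d n * z ^ n) z := by
  obtain ⟨r, hzr, hr⟩ := exists_between hz
  have hr0 : 0 < r := (norm_nonneg z).trans_lt hzr
  refine hasDerivAt_tsum_of_isPreconnected (g := fun n z => d n / ((n : ℂ) + 1) * z ^ (n + 1))
    (g' := fun n z => d n * z ^ n) (summable_succ_mul_pow hr0.le hr)
    (t := Metric.ball 0 r) Metric.isOpen_ball (convex_ball _ _).isPreconnected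
    (y₀ := 0) ?_ ?_ (by simpa using hr0) (by simp [summable_zero]) (by simpa using hzr)
  · intro n y _
    have h := (hasDerivAt_pow (n + 1) y).const_mul (d n / ((n : ℂ) + 1))
    refine h.congr_deriv ?_
    have : (n : ℂ) + 1 ≠ 0 := by exact_mod_cast n.succ_ne_zero
    rw [Nat.add_sub_cancel]
    push_cast
    field_simp
  · intro n y hy
    have hy : ‖y‖ < r := by simpa using hy
    rw [norm_mul, norm_pow]
    exact mul_le_mul (hd n) (pow_le_pow_left₀ (norm_nonneg _) hy.le n) (by positivity)
      (by positivity)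

/-- The polylogarithm `∑ zⁿ/nˢ` of integer order on the closed unit disc. -/
noncomputable def polylog (s : ℕ) : ℂ → ℂ := psum fun n => 1 / (n + 1 : ℂ) ^ s

lemma norm_natCast_add_one (n : ℕ) : ‖(n + 1 : ℂ)‖ = n + 1 := by
  rw [← Nat.cast_succ, Complex.norm_natCast, Nat.cast_succ]

lemma summable_one_div_succ_pow {s : ℕ} (hs : 2 ≤ s) :
    Summable fun n : ℕ => ‖1 / (n + 1 : ℂ) ^ s‖ := by
  have h := (summable_nat_add_iff 1).2 (Real.summable_one_div_nat_pow.2 hs)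
  refine h.congr fun n => ?_
  rw [norm_div, norm_pow, norm_natCast_add_one]
  simp

lemma hasDerivAt_polylog (s : ℕ) {z : ℂ} (hz : ‖z‖ < 1) (hz0 : z ≠ 0) :
    HasDerivAt (polylog (s + 1)) (polylog s z / z) z := by
  have h := hasDerivAt_psum (d := fun n => 1 / (n + 1 : ℂ) ^ s) (fun n => ?_) hz
  · convert h using 1
    · unfold polylog
      congr 1; ext n
      rw [div_div, pow_succ]
    · rw [div_eq_iff hz0, ← tsum_mul_right]
      unfold polylog psum
      congr 1; ext n
      ring
  · rw [norm_div, norm_pow, norm_natCast_add_one, norm_one]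
    have : (1 : ℝ) ≤ n + 1 := by simp
    exact (div_le_self zero_le_one (one_le_pow₀ this)).trans this

lemma hasSum_polylog_one {z : ℂ} (hz : ‖z‖ < 1) :
    HasSum (fun n : ℕ => 1 / (n + 1 : ℂ) ^ 1 * z ^ (n + 1)) (-log (1 - z)) := by
  have h := (hasSum_nat_add_iff' 1).2 (hasSum_taylorSeries_neg_log hz)
  simp only [Finset.range_one, Finset.sum_singleton, pow_zero, Nat.cast_zero, div_zero,
    sub_zero] at h
  refine h.congr_fun fun n => ?_
  push_cast; ring

lemma polylog_one {z : ℂ} (hz : ‖z‖ < 1) : polylog 1 z = -log (1 - z) :=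
  (hasSum_polylog_one hz).tsum_eq

lemma hasDerivAt_polylog_two {z : ℂ} (hz : ‖z‖ < 1) (hz0 : z ≠ 0) :
    HasDerivAt (polylog 2) (-log (1 - z) / z) z :=
  polylog_one hz ▸ hasDerivAt_polylog 1 hz hz0

/-! ### Harmonic numbers -/

lemma harmonic_le_self (n : ℕ) : (harmonic n : ℝ) ≤ n := by
  induction n with
  | zero => simp
  | succ n ih =>
    rw [harmonic_succ]; push_cast
    have : ((n : ℝ) + 1)⁻¹ ≤ 1 := inv_le_one_of_one_le₀ (by simp)
    linarith

lemma harmonic_nonneg (n : ℕ) : (0 : ℝ) ≤ harmonic n := by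
  exact_mod_cast Finset.sum_nonneg fun i _ => by positivity

lemma harmonic_le_two_mul_sqrt (n : ℕ) : (harmonic n : ℝ) ≤ 2 * √n := by
  induction n with
  | zero => simp
  | succ n ih =>
    rw [harmonic_succ]; push_cast
    have h0 : 0 < √((n : ℝ) + 1) := by positivity
    have h1 : √((n : ℝ) + 1) ^ 2 = n + 1 := Real.sq_sqrt (by positivity)
    have h2 : √(n : ℝ) ^ 2 = n := Real.sq_sqrt (by positivity)
    have h3 : √(n : ℝ) ≤ √((n : ℝ) + 1) := Real.sqrt_le_sqrt (by simp)
    have h4 : ((n : ℝ) + 1)⁻¹ ≤ 2 * (√((n : ℝ) + 1) - √n) := by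
      rw [inv_le_iff_one_le_mul₀ (by positivity)]
      have h5 : 1 ≤ √((n : ℝ) + 1) := Real.one_le_sqrt.2 (by simp)
      have h6 : 1 ≤ 2 * (√((n : ℝ) + 1) - √n) * √((n : ℝ) + 1) := by
        nlinarith [Real.sqrt_nonneg (n : ℝ), mul_nonneg (sub_nonneg.2 h3) (sub_nonneg.2 h3)]
      nlinarith
    linarith

lemma summable_harmonic_div_sq :
    Summable fun n : ℕ => (harmonic (n + 1) : ℝ) / (n + 1 : ℝ) ^ 2 := by
  have h := ((summable_nat_add_iff 1).2
    (Real.summable_one_div_nat_rpow.2 (by norm_num : (1 : ℝ) < 3 / 2))).mul_left 2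
  refine .of_nonneg_of_le (fun n => div_nonneg (harmonic_nonneg _) (by positivity)) (fun n => ?_) h
  refine (div_le_div_of_nonneg_right (harmonic_le_two_mul_sqrt _) (by positivity)).trans_eq ?_
  have h0 : (0 : ℝ) < n + 1 := by positivity
  push_cast
  rw [Real.sqrt_eq_rpow, mul_div_assoc, ← Real.rpow_natCast, ← Real.rpow_sub h0, one_div (_ ^ _),
    ← Real.rpow_neg h0.le]
  norm_num

/-- The generating function `∑ Hₙ zⁿ/nˢ`. -/
noncomputable def eulerSum (s : ℕ) : ℂ → ℂ :=
  psum fun n => (harmonic (n + 1) : ℝ) / (n + 1 : ℂ) ^ s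

lemma norm_harmonic_le (n : ℕ) : ‖(((harmonic (n + 1) : ℝ)) : ℂ)‖ ≤ n + 1 := by
  rw [Complex.norm_real, Real.norm_of_nonneg (harmonic_nonneg _)]
  exact_mod_cast harmonic_le_self (n + 1)

lemma summable_norm_harmonic_div_sq :
    Summable fun n : ℕ => ‖((harmonic (n + 1) : ℝ) : ℂ) / (n + 1 : ℂ) ^ 2‖ := by
  refine summable_harmonic_div_sq.congr fun n => ?_
  rw [norm_div, norm_pow, norm_natCast_add_one, Complex.norm_real,
    Real.norm_of_nonneg (harmonic_nonneg _)]

lemma tsum_harmonic_mul_pow {z : ℂ} (hz : ‖z‖ < 1) :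
    (1 - z) * z * ∑' n : ℕ, ((harmonic (n + 1) : ℝ) : ℂ) * z ^ n = -log (1 - z) := by
  have hs := summable_mul_pow_of_norm_le_succ norm_harmonic_le hz
  have hl := (hasSum_polylog_one hz).summable
  have h1 := hs.tsum_eq_zero_add
  rw [← (hasSum_polylog_one hz).tsum_eq, hl.tsum_eq_zero_add]
  have h2 : z * ∑' n : ℕ, ((harmonic (n + 1 + 1) : ℝ) : ℂ) * z ^ (n + 1) =
      z * z * (∑' n : ℕ, ((harmonic (n + 1) : ℝ) : ℂ) * z ^ n) +
      ∑' n : ℕ, 1 / (((n + 1 : ℕ) : ℂ) + 1) ^ 1 * z ^ (n + 1 + 1) := by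
    rw [← tsum_mul_left, ← tsum_mul_left, ← (hs.mul_left _).tsum_add ((summable_nat_add_iff 1).2 hl)]
    congr 1; ext n
    rw [harmonic_succ (n + 1)]
    push_cast
    ring
  have h3 : (((harmonic (0 + 1) : ℝ)) : ℂ) = 1 := by simp [harmonic_succ]
  rw [h3] at h1
  have h4 := congrArg (z * ·) h1
  simp only [mul_add, h2] at h4
  linear_combination h4

lemma one_sub_mem_slitPlane {z : ℂ} (hz : ‖z‖ < 1) : 1 - z ∈ slitPlane := by
  left
  have := (Complex.abs_re_le_norm z).trans_lt hz
  rw [abs_lt] at this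
  simp; linarith

lemma hasDerivAt_log_one_sub {z : ℂ} (hz : ‖z‖ < 1) :
    HasDerivAt (fun w => log (1 - w)) (-1 / (1 - z)) z :=
  ((hasDerivAt_id z).const_sub 1).clog (one_sub_mem_slitPlane hz)

lemma eulerSum_one {z : ℂ} (hz : ‖z‖ < 1) :
    eulerSum 1 z = polylog 2 z + log (1 - z) ^ 2 / 2 := by
  have key : ∀ y ∈ Metric.ball (0 : ℂ) 1,
      HasDerivAt (fun w => eulerSum 1 w - polylog 2 w - log (1 - w) ^ 2 / 2) 0 y := by
    intro y hy
    have hy : ‖y‖ < 1 := by simpa using hy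
    have h1 : HasDerivAt (eulerSum 1) (∑' n : ℕ, ((harmonic (n + 1) : ℝ) : ℂ) * y ^ n) y := by
      convert hasDerivAt_psum norm_harmonic_le hy using 1
      unfold eulerSum; simp only [pow_one]
    have h2 : HasDerivAt (polylog 2) (∑' n : ℕ, (1 / (n + 1 : ℂ)) * y ^ n) y := by
      convert hasDerivAt_psum (d := fun n => 1 / (n + 1 : ℂ)) (fun n => ?_) hy using 1
      · unfold polylog
        congr 1; ext n
        rw [div_div, pow_two]
      · rw [norm_div, norm_natCast_add_one, norm_one]
        have : (1 : ℝ) ≤ n + 1 := by simp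
        exact (div_le_self zero_le_one this).trans this
    have h3 := ((hasDerivAt_log_one_sub hy).pow 2).div_const 2
    refine ((h1.sub h2).sub h3).congr_deriv ?_
    by_cases hy0 : y = 0
    · subst hy0
      rw [tsum_eq_single 0 (by intro b hb; simp [hb]), tsum_eq_single 0 (by intro b hb; simp [hb])]
      simp [harmonic_succ]
    · have h4 := tsum_harmonic_mul_pow hy
      have h5 : y * ∑' n : ℕ, (1 / (n + 1 : ℂ)) * y ^ n = -log (1 - y) := by
        rw [← (hasSum_polylog_one hy).tsum_eq, ← tsum_mul_left]
        congr 1; ext n; ring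
      have h6 : 1 - y ≠ 0 := slitPlane_ne_zero (one_sub_mem_slitPlane hy)
      generalize (∑' n : ℕ, ((harmonic (n + 1) : ℝ) : ℂ) * y ^ n) = a at *
      generalize (∑' n : ℕ, (1 / (n + 1 : ℂ)) * y ^ n) = b at *
      obtain rfl : a = -log (1 - y) / ((1 - y) * y) := by
        rw [eq_div_iff (mul_ne_zero h6 hy0)]; linear_combination h4
      obtain rfl : b = -log (1 - y) / y := by rw [eq_div_iff hy0]; linear_combination h5
      simp only [Nat.add_one_sub_one, pow_one]
      field_simp
      push_cast
      ring
  have hc := (convex_ball (0 : ℂ) 1).isPreconnected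
  have := Metric.isOpen_ball.is_const_of_deriv_eq_zero hc
    (fun y hy => (key y hy).differentiableAt.differentiableWithinAt)
    (fun y hy => (key y hy).deriv) (x := z) (y := 0) (by simpa using hz) (by simp)
  simp only [eulerSum, polylog, psum_zero] at this ⊢
  simp at this
  simp
  linear_combination this

lemma hasDerivAt_eulerSum_two {z : ℂ} (hz : ‖z‖ < 1) (hz0 : z ≠ 0) :
    HasDerivAt (fun w => eulerSum 2 w - polylog 3 w) (log (1 - z) ^ 2 / (2 * z)) z := by
  have h1 : HasDerivAt (eulerSum 2) (eulerSum 1 z / z) z := by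
    convert hasDerivAt_psum (d := fun n => ((harmonic (n + 1) : ℝ) : ℂ) / (n + 1 : ℂ))
      (fun n => ?_) hz using 1
    · unfold eulerSum
      congr 1; ext n
      rw [div_div, pow_two]
    · rw [div_eq_iff hz0, ← tsum_mul_right]
      unfold eulerSum psum
      congr 1; ext n
      ring
    · rw [norm_div, norm_natCast_add_one]
      have : (1 : ℝ) ≤ n + 1 := by simp
      exact (div_le_self (norm_nonneg _) this).trans (norm_harmonic_le n)
  refine (h1.sub (hasDerivAt_polylog 2 hz hz0)).congr_deriv ?_
  rw [eulerSum_one hz]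
  field_simp
  ring

lemma eq_of_hasDerivAt_zero {f : ℝ → ℂ} {b : ℝ} (hb : 0 ≤ b) (hc : ContinuousOn f (Icc 0 b))
    (hd : ∀ t ∈ Ioo 0 b, HasDerivAt f 0 t) : f b = f 0 := by
  have := intervalIntegral.integral_eq_sub_of_hasDerivAt_of_le hb hc hd (by simp)
  simp only [intervalIntegral.integral_zero] at this
  exact (sub_eq_zero.1 this.symm)

lemma continuousOn_mul_log {f : ℝ → ℂ} {s : Set ℝ} (hf : ContinuousOn f s) (hs : s ∈ 𝓝 0)
    (hd : DifferentiableAt ℝ f 0) (h0 : f 0 = 0) :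
    ContinuousOn (fun t : ℝ => f t * (Real.log t : ℂ)) s := by
  have h1 : ContinuousOn (dslope f 0) s := (continuousOn_dslope hs).2 ⟨hf, hd⟩
  have h2 : Continuous fun t : ℝ => ((t * Real.log t : ℝ) : ℂ) :=
    continuous_ofReal.comp Real.continuous_mul_log
  refine (h2.continuousOn.mul h1).congr fun t _ => ?_
  have h3 := sub_smul_dslope f 0 t
  rw [h0, sub_zero, sub_zero] at h3
  rw [← h3, real_smul]
  simp only [Pi.mul_apply]
  push_cast
  ring

lemma continuousOn_polylog {s : ℕ} (hs : 2 ≤ s) {γ : ℝ → ℂ} {u : Set ℝ} (hγ : ContinuousOn γ u)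
    (h : ∀ t ∈ u, ‖γ t‖ ≤ 1) : ContinuousOn (fun t => polylog s (γ t)) u :=
  (continuousOn_psum (summable_one_div_succ_pow hs)).comp hγ fun t ht => by simpa using h t ht

lemma continuousOn_eulerSum_two {γ : ℝ → ℂ} {u : Set ℝ} (hγ : ContinuousOn γ u)
    (h : ∀ t ∈ u, ‖γ t‖ ≤ 1) : ContinuousOn (fun t => eulerSum 2 (γ t)) u :=
  (continuousOn_psum summable_norm_harmonic_div_sq).comp hγ fun t ht => by simpa using h t ht

lemma polylog_zero_right (s : ℕ) : polylog s 0 = 0 := psum_zero _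

lemma eulerSum_zero_right (s : ℕ) : eulerSum s 0 = 0 := psum_zero _

lemma polylog_two_one : polylog 2 1 = (Real.pi : ℂ) ^ 2 / 6 := by
  have h := (hasSum_nat_add_iff' 1).2 hasSum_zeta_two
  simp only [Finset.range_one, Finset.sum_singleton, Nat.cast_zero] at h
  have h2 := Complex.hasSum_ofReal.2 h
  unfold polylog psum
  convert h2.tsum_eq using 2
  · ext n; simp
  · simp

lemma polylog_three_one : polylog 3 1 = (zeta3 : ℂ) := by
  unfold polylog psum zeta3
  rw [ofReal_tsum]
  congr 1; ext n; simp

/-! ### Values at `1 / 2` -/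

lemma norm_ofReal_lt_one {t : ℝ} (h0 : 0 < t) (h1 : t < 1) : ‖(t : ℂ)‖ < 1 := by
  rwa [norm_real, Real.norm_of_nonneg h0.le]

lemma norm_one_sub_ofReal_lt_one {t : ℝ} (h0 : 0 < t) (h1 : t < 1) : ‖(1 - t : ℂ)‖ < 1 := by
  have := norm_ofReal_lt_one (t := 1 - t) (by linarith) (by linarith)
  exact_mod_cast this

lemma continuousOn_log_one_sub :
    ContinuousOn (fun t : ℝ => log (1 - t : ℂ)) (Iio 1) := by
  refine ContinuousOn.clog (by fun_prop) fun t ht => ?_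
  left; simpa using ht

lemma continuousOn_log_one_sub_mul_log :
    ContinuousOn (fun t : ℝ => log (1 - t : ℂ) * (Real.log t : ℂ)) (Iio 1) := by
  refine continuousOn_mul_log continuousOn_log_one_sub (Iio_mem_nhds one_pos) ?_ (by simp)
  exact ((hasDerivAt_log_one_sub (z := ((0 : ℝ) : ℂ)) (by simp)).comp_ofReal).differentiableAt

lemma hasDerivAt_polylog_two_one_sub {t : ℝ} (h0 : 0 < t) (h1 : t < 1) :
    HasDerivAt (fun w : ℂ => polylog 2 (1 - w)) (log t / (1 - t)) t := by
  have hz : (1 - t : ℂ) ≠ 0 := by exact_mod_cast (sub_pos.2 h1).ne'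
  refine ((hasDerivAt_polylog_two (norm_one_sub_ofReal_lt_one h0 h1) hz).comp (t : ℂ)
    ((hasDerivAt_id _).const_sub 1)).congr_deriv ?_
  rw [sub_sub_cancel]; ring

lemma Icc_half_subset : Icc (0 : ℝ) (1 / 2) ⊆ Iio 1 := fun t ht => by
  have := ht.2; simp only [mem_Iio]; linarith

lemma norm_le_one_of_mem_half {t : ℝ} (ht : t ∈ Icc (0 : ℝ) (1 / 2)) :
    ‖(t : ℂ)‖ ≤ 1 ∧ ‖(1 - t : ℂ)‖ ≤ 1 := by
  obtain ⟨h0, h1⟩ := ht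
  rw [← ofReal_one, ← ofReal_sub, norm_real, norm_real, Real.norm_of_nonneg h0,
    Real.norm_of_nonneg (by linarith)]
  constructor <;> linarith

lemma log_half : log (((1 / 2 : ℝ)) : ℂ) = -(Real.log 2 : ℂ) := by
  rw [← ofReal_log (by norm_num), one_div, Real.log_inv, ofReal_neg]

lemma polylog_two_half : polylog 2 (1 / 2) = (Real.pi : ℂ) ^ 2 / 12 - (Real.log 2 : ℂ) ^ 2 / 2 := by
  have key := eq_of_hasDerivAt_zero (b := 1 / 2) (by norm_num)
    (f := fun t : ℝ => polylog 2 t + polylog 2 (1 - t) + log (1 - t) * log t) ?_ ?_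
  · simp only [ofReal_zero, sub_zero, polylog_zero_right, polylog_two_one, log_zero, mul_zero,
      log_half] at key
    have h : (1 : ℂ) - ((1 / 2 : ℝ) : ℂ) = ((1 / 2 : ℝ) : ℂ) := by push_cast; norm_num
    rw [h, log_half] at key
    push_cast at key
    linear_combination key / 2
  · refine ((continuousOn_polylog le_rfl (by fun_prop) fun t ht => ?_).add
      (continuousOn_polylog le_rfl (by fun_prop) fun t ht => ?_)).add
      ((continuousOn_log_one_sub_mul_log.mono Icc_half_subset).congr fun t ht => ?_)
    · exact (norm_le_one_of_mem_half ht).1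
    · exact (norm_le_one_of_mem_half ht).2
    · simp only [ofReal_log ht.1]
  · rintro t ⟨h0, h1⟩
    have h1 : t < 1 := by linarith
    have hz : (t : ℂ) ≠ 0 := by exact_mod_cast h0.ne'
    have hz1 : (1 - t : ℂ) ≠ 0 := by exact_mod_cast (sub_pos.2 h1).ne'
    have hs : (t : ℂ) ∈ slitPlane := by left; simpa using h0
    refine (((((hasDerivAt_polylog_two (norm_ofReal_lt_one h0 h1) hz).add
      (hasDerivAt_polylog_two_one_sub h0 h1)).add
      ((hasDerivAt_log_one_sub (norm_ofReal_lt_one h0 h1)).mul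
        (hasDerivAt_log hs))).comp_ofReal).congr_deriv ?_)
    field_simp
    ring

lemma eulerSum_two_half :
    eulerSum 2 (1 / 2) = (zeta3 : ℂ) - (Real.pi : ℂ) ^ 2 * (Real.log 2 : ℂ) / 12 := by
  have key := eq_of_hasDerivAt_zero (b := 1 / 2) (by norm_num)
    (f := fun t : ℝ => (eulerSum 2 t - polylog 3 t) + polylog 3 (1 - t)
      - log (1 - t) * polylog 2 (1 - t) - log (1 - t) * (log (1 - t) * log t) / 2) ?_ ?_
  · simp only [ofReal_zero, sub_zero, polylog_zero_right, polylog_three_one, log_zero, mul_zero,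
      log_half, eulerSum_zero_right, log_one] at key
    have h : (1 : ℂ) - ((1 / 2 : ℝ) : ℂ) = ((1 / 2 : ℝ) : ℂ) := by push_cast; norm_num
    rw [h, log_half] at key
    push_cast at key
    rw [polylog_two_half] at key
    linear_combination key
  · have hl := continuousOn_log_one_sub.mono Icc_half_subset
    refine ((((continuousOn_eulerSum_two (by fun_prop) fun t ht => ?_).sub
      (continuousOn_polylog (by norm_num) (by fun_prop) fun t ht => ?_)).add
      (continuousOn_polylog (by norm_num) (by fun_prop) fun t ht => ?_)).sub
      (hl.mul (continuousOn_polylog le_rfl (by fun_prop) fun t ht => ?_))).sub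
      ((hl.mul ((continuousOn_log_one_sub_mul_log.mono Icc_half_subset).congr
        fun t ht => ?_)).div_const 2)
    · exact (norm_le_one_of_mem_half ht).1
    · exact (norm_le_one_of_mem_half ht).1
    · exact (norm_le_one_of_mem_half ht).2
    · exact (norm_le_one_of_mem_half ht).2
    · simp only [ofReal_log ht.1]
  · rintro t ⟨h0, h1⟩
    have h1 : t < 1 := by linarith
    have hz : (t : ℂ) ≠ 0 := by exact_mod_cast h0.ne'
    have hz1 : (1 - t : ℂ) ≠ 0 := by exact_mod_cast (sub_pos.2 h1).ne'
    have hs : (t : ℂ) ∈ slitPlane := by left; simpa using h0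
    have hn := norm_ofReal_lt_one h0 h1
    have hl := hasDerivAt_log_one_sub hn
    have hp : HasDerivAt (fun w : ℂ => polylog 3 (1 - w)) (polylog 2 (1 - t) / (1 - t) * (-1)) t :=
      (hasDerivAt_polylog 2 (norm_one_sub_ofReal_lt_one h0 h1) hz1).comp (t : ℂ)
        ((hasDerivAt_id _).const_sub 1)
    refine ((((((hasDerivAt_eulerSum_two hn hz).add hp).sub
      (hl.mul (hasDerivAt_polylog_two_one_sub h0 h1))).sub
      ((hl.mul (hl.mul (hasDerivAt_log hs))).div_const 2)).comp_ofReal).congr_deriv ?_)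
    simp only [Pi.mul_apply]
    field_simp
    ring

/-! ### Values at `I` -/

lemma normSq_one_sub_I_mul (t : ℝ) : normSq (1 - I * t) = 1 + t ^ 2 := by
  simp [normSq_apply]; ring

lemma norm_one_sub_I_mul_sq (t : ℝ) : ‖1 - I * t‖ ^ 2 = 1 + t ^ 2 := by
  rw [← normSq_eq_norm_sq, normSq_one_sub_I_mul]

lemma one_le_norm_one_sub_I_mul (t : ℝ) : 1 ≤ ‖1 - I * t‖ := by
  have := norm_one_sub_I_mul_sq t
  nlinarith [norm_nonneg (1 - I * t), sq_nonneg t]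

lemma one_sub_I_mul_ne_zero (t : ℝ) : 1 - I * (t : ℂ) ≠ 0 :=
  norm_pos_iff.1 (one_pos.trans_le (one_le_norm_one_sub_I_mul t))

lemma one_sub_I_mul_mem_slitPlane (t : ℝ) : 1 - I * (t : ℂ) ∈ slitPlane := by
  left; simp

lemma norm_inv_one_sub_I_mul_le (t : ℝ) : ‖1 / (1 - I * t)‖ ≤ 1 := by
  rw [norm_div, norm_one]
  exact div_le_one_of_le₀ (one_le_norm_one_sub_I_mul t) (norm_nonneg _)

lemma norm_neg_I_mul_div_lt (t : ℝ) : ‖-(I * t) / (1 - I * t)‖ < 1 := by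
  rw [norm_div, div_lt_one (norm_pos_iff.2 (one_sub_I_mul_ne_zero t)), norm_neg, norm_mul, norm_I,
    one_mul, norm_real]
  have := norm_one_sub_I_mul_sq t
  refine lt_of_pow_lt_pow_left₀ 2 (norm_nonneg _) ?_
  rw [this, Real.norm_eq_abs, sq_abs]
  linarith

lemma norm_inv_one_sub_I_mul_lt {t : ℝ} (h0 : 0 < t) : ‖1 / (1 - I * t)‖ < 1 := by
  rw [norm_div, norm_one, div_lt_one (norm_pos_iff.2 (one_sub_I_mul_ne_zero t))]
  have := norm_one_sub_I_mul_sq t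
  refine lt_of_pow_lt_pow_left₀ 2 (norm_nonneg _) ?_
  rw [this]
  nlinarith

lemma norm_I_mul_le {t : ℝ} (ht : t ∈ Icc (0 : ℝ) 1) : ‖I * (t : ℂ)‖ ≤ 1 := by
  rw [norm_mul, norm_I, one_mul, norm_real, Real.norm_of_nonneg ht.1]
  exact ht.2

lemma one_sub_inv_one_sub_I_mul (t : ℝ) :
    1 - 1 / (1 - I * (t : ℂ)) = -(I * t) / (1 - I * t) := by
  have := one_sub_I_mul_ne_zero t
  field_simp
  ring

lemma one_sub_neg_I_mul_div (t : ℝ) :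
    1 - -(I * t) / (1 - I * t) = 1 / (1 - I * (t : ℂ)) := by
  rw [← one_sub_inv_one_sub_I_mul, sub_sub_cancel]

lemma abs_im_log_one_sub_I_mul (t : ℝ) : |(log (1 - I * t)).im| < Real.pi / 2 := by
  rw [log_im]
  exact abs_arg_lt_pi_div_two_iff.2 (Or.inl (by simp))

lemma log_inv_one_sub_I_mul (t : ℝ) : log (1 / (1 - I * t)) = -log (1 - I * t) := by
  rw [one_div, log_inv]
  exact slitPlane_arg_ne_pi (one_sub_I_mul_mem_slitPlane t)

lemma log_neg_I_mul_div {t : ℝ} (h0 : 0 < t) :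
    log (-(I * t) / (1 - I * t)) = log t - I * (Real.pi / 2) - log (1 - I * t) := by
  have hz : (t : ℂ) ≠ 0 := by exact_mod_cast h0.ne'
  have h : -(I * t) / (1 - I * t) = exp (log t - I * (Real.pi / 2) - log (1 - I * t)) := by
    rw [exp_sub, exp_sub, exp_log hz, exp_log (one_sub_I_mul_ne_zero t), mul_comm I (_ / 2),
      exp_pi_div_two_mul_I, div_I]
    ring
  have him := abs_lt.1 (abs_im_log_one_sub_I_mul t)
  have h2 : (log t - I * (Real.pi / 2) - log (1 - I * t)).im
      = -(Real.pi / 2) - (log (1 - I * t)).im := by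
    rw [← ofReal_log h0.le]
    simp
  rw [h, log_exp]
  · rw [h2]; linarith
  · rw [h2]; linarith [Real.pi_pos]

lemma hasDerivAt_log_one_sub_I_mul (t : ℝ) :
    HasDerivAt (fun w : ℂ => log (1 - I * w)) (-I / (1 - I * t)) t := by
  have h : HasDerivAt (fun w : ℂ => 1 - I * w) (-I) t := by
    simpa using ((hasDerivAt_id (t : ℂ)).const_mul I).const_sub 1
  exact h.clog (one_sub_I_mul_mem_slitPlane t)

lemma hasDerivAt_inv_one_sub_I_mul (t : ℝ) :
    HasDerivAt (fun w : ℂ => 1 / (1 - I * w)) (I / (1 - I * t) ^ 2) t := by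
  have h : HasDerivAt (fun w : ℂ => 1 - I * w) (-I) t := by
    simpa using ((hasDerivAt_id (t : ℂ)).const_mul I).const_sub 1
  simp only [one_div]
  exact (h.inv (one_sub_I_mul_ne_zero t)).congr_deriv (by rw [neg_neg])

lemma hasDerivAt_neg_I_mul_div (t : ℝ) :
    HasDerivAt (fun w : ℂ => -(I * w) / (1 - I * w)) (-I / (1 - I * t) ^ 2) t := by
  have h1 : HasDerivAt (fun w : ℂ => I * w) I t := by
    simpa using (hasDerivAt_id (t : ℂ)).const_mul I
  refine (h1.neg.div (h1.const_sub 1) (one_sub_I_mul_ne_zero t)).congr_deriv ?_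
  simp only [Pi.neg_apply]
  congr 1; ring

section Derivatives

variable {t : ℝ}

lemma norm_I_mul_lt (h0 : 0 < t) (h1 : t < 1) : ‖I * (t : ℂ)‖ < 1 := by
  rw [norm_mul, norm_I, one_mul, norm_real, Real.norm_of_nonneg h0.le]
  exact h1

lemma I_mul_ne_zero (h0 : 0 < t) : I * (t : ℂ) ≠ 0 :=
  mul_ne_zero I_ne_zero (by exact_mod_cast h0.ne')

lemma hasDerivAt_I_mul (t : ℝ) : HasDerivAt (fun w : ℂ => I * w) I t := by
  simpa using (hasDerivAt_id (t : ℂ)).const_mul I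

lemma hasDerivAt_polylog_two_I_mul (h0 : 0 < t) (h1 : t < 1) :
    HasDerivAt (fun w : ℂ => polylog 2 (I * w)) (-log (1 - I * t) / t) t := by
  have hz : (t : ℂ) ≠ 0 := by exact_mod_cast h0.ne'
  refine ((hasDerivAt_polylog_two (norm_I_mul_lt h0 h1) (I_mul_ne_zero h0)).comp (t : ℂ)
    (hasDerivAt_I_mul t)).congr_deriv ?_
  field_simp [I_ne_zero]

lemma hasDerivAt_polylog_three_I_mul (h0 : 0 < t) (h1 : t < 1) :
    HasDerivAt (fun w : ℂ => polylog 3 (I * w)) (polylog 2 (I * t) / t) t := by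
  have hz : (t : ℂ) ≠ 0 := by exact_mod_cast h0.ne'
  refine ((hasDerivAt_polylog 2 (norm_I_mul_lt h0 h1) (I_mul_ne_zero h0)).comp (t : ℂ)
    (hasDerivAt_I_mul t)).congr_deriv ?_
  field_simp [I_ne_zero]

lemma hasDerivAt_eulerSum_two_I_mul (h0 : 0 < t) (h1 : t < 1) :
    HasDerivAt (fun w : ℂ => eulerSum 2 (I * w) - polylog 3 (I * w))
      (log (1 - I * t) ^ 2 / (2 * t)) t := by
  have hz : (t : ℂ) ≠ 0 := by exact_mod_cast h0.ne'
  refine ((hasDerivAt_eulerSum_two (norm_I_mul_lt h0 h1) (I_mul_ne_zero h0)).comp (t : ℂ)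
    (hasDerivAt_I_mul t)).congr_deriv ?_
  field_simp [I_ne_zero]

lemma hasDerivAt_polylog_two_inv (h0 : 0 < t) :
    HasDerivAt (fun w : ℂ => polylog 2 (1 / (1 - I * w)))
      (-(log t - I * (Real.pi / 2) - log (1 - I * t)) * I / (1 - I * t)) t := by
  have hp := one_sub_I_mul_ne_zero t
  refine ((hasDerivAt_polylog_two (norm_inv_one_sub_I_mul_lt h0) (one_div_ne_zero hp)).comp (t : ℂ)
    (hasDerivAt_inv_one_sub_I_mul t)).congr_deriv ?_
  rw [one_sub_inv_one_sub_I_mul, log_neg_I_mul_div h0]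
  field_simp

lemma hasDerivAt_polylog_three_inv (h0 : 0 < t) :
    HasDerivAt (fun w : ℂ => polylog 3 (1 / (1 - I * w)))
      (polylog 2 (1 / (1 - I * t)) * I / (1 - I * t)) t := by
  have hp := one_sub_I_mul_ne_zero t
  refine ((hasDerivAt_polylog 2 (norm_inv_one_sub_I_mul_lt h0) (one_div_ne_zero hp)).comp (t : ℂ)
    (hasDerivAt_inv_one_sub_I_mul t)).congr_deriv ?_
  generalize polylog 2 (1 / (1 - I * t)) = q
  field_simp

lemma hasDerivAt_polylog_two_neg_div (h0 : 0 < t) :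
    HasDerivAt (fun w : ℂ => polylog 2 (-(I * w) / (1 - I * w)))
      (log (1 - I * t) / (t * (1 - I * t))) t := by
  have hp := one_sub_I_mul_ne_zero t
  have hz : (t : ℂ) ≠ 0 := by exact_mod_cast h0.ne'
  refine ((hasDerivAt_polylog_two (norm_neg_I_mul_div_lt t)
    (div_ne_zero (neg_ne_zero.2 (I_mul_ne_zero h0)) hp)).comp (t : ℂ)
    (hasDerivAt_neg_I_mul_div t)).congr_deriv ?_
  rw [one_sub_neg_I_mul_div, log_inv_one_sub_I_mul]
  field_simp [I_ne_zero]

lemma hasDerivAt_polylog_three_neg_div (h0 : 0 < t) :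
    HasDerivAt (fun w : ℂ => polylog 3 (-(I * w) / (1 - I * w)))
      (polylog 2 (-(I * t) / (1 - I * t)) / (t * (1 - I * t))) t := by
  have hp := one_sub_I_mul_ne_zero t
  have hz : (t : ℂ) ≠ 0 := by exact_mod_cast h0.ne'
  refine ((hasDerivAt_polylog 2 (norm_neg_I_mul_div_lt t)
    (div_ne_zero (neg_ne_zero.2 (I_mul_ne_zero h0)) hp)).comp (t : ℂ)
    (hasDerivAt_neg_I_mul_div t)).congr_deriv ?_
  generalize polylog 2 (-(I * t) / (1 - I * t)) = q
  field_simp [I_ne_zero]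

end Derivatives

lemma ne_zero_and_mem_slitPlane {t : ℝ} (h0 : 0 < t) : (t : ℂ) ≠ 0 ∧ (t : ℂ) ∈ slitPlane :=
  ⟨by exact_mod_cast h0.ne', by left; simpa using h0⟩

lemma continuous_log_one_sub_I_mul : Continuous fun t : ℝ => log (1 - I * (t : ℂ)) :=
  Continuous.clog (by fun_prop) one_sub_I_mul_mem_slitPlane

lemma continuousOn_log_one_sub_I_mul_mul_log :
    ContinuousOn (fun t : ℝ => log (1 - I * (t : ℂ)) * log t) (Icc 0 1) := by
  refine ((continuousOn_mul_log continuous_log_one_sub_I_mul.continuousOn univ_mem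
    (hasDerivAt_log_one_sub_I_mul 0).comp_ofReal.differentiableAt (by simp)).mono
    (subset_univ _)).congr fun t ht => ?_
  simp only [ofReal_log ht.1]

lemma continuous_inv_one_sub_I_mul : Continuous fun t : ℝ => 1 / (1 - I * (t : ℂ)) :=
  Continuous.div₀ (by fun_prop) (by fun_prop) one_sub_I_mul_ne_zero

lemma continuous_neg_I_mul_div : Continuous fun t : ℝ => -(I * (t : ℂ)) / (1 - I * (t : ℂ)) :=
  Continuous.div₀ (by fun_prop) (by fun_prop) one_sub_I_mul_ne_zero

/-- Landen's identity for the dilogarithm along the segment from `0` to `I`. -/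
lemma polylog_two_landen {s : ℝ} (h0 : 0 ≤ s) (h1 : s ≤ 1) :
    polylog 2 (-(I * s) / (1 - I * s)) + polylog 2 (I * s) + log (1 - I * s) ^ 2 / 2 = 0 := by
  have key := eq_of_hasDerivAt_zero (b := s) h0
    (f := fun t : ℝ => polylog 2 (-(I * t) / (1 - I * t)) + polylog 2 (I * t)
      + log (1 - I * t) ^ 2 / 2) ?_ ?_
  · simpa [polylog_zero_right] using key
  · exact ((continuousOn_polylog le_rfl continuous_neg_I_mul_div.continuousOn
        fun t ht => (norm_neg_I_mul_div_lt t).le).add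
      (continuousOn_polylog le_rfl (by fun_prop)
        fun t ht => norm_I_mul_le ⟨ht.1, ht.2.trans h1⟩)).add
      ((continuous_log_one_sub_I_mul.pow 2).div_const 2).continuousOn
  · rintro t ⟨ht0, ht1⟩
    obtain ⟨hz, -⟩ := ne_zero_and_mem_slitPlane ht0
    have hp := one_sub_I_mul_ne_zero t
    refine ((((hasDerivAt_polylog_two_neg_div ht0).add
      (hasDerivAt_polylog_two_I_mul ht0 (ht1.trans_le h1))).add
      (((hasDerivAt_log_one_sub_I_mul t).pow 2).div_const 2)).comp_ofReal).congr_deriv ?_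
    field_simp
    push_cast
    ring

/-- Euler's reflection formula for the dilogarithm along the circle arc
`1 / (1 - I * s)`. -/
lemma polylog_two_reflection {s : ℝ} (h0 : 0 ≤ s) (h1 : s ≤ 1) :
    polylog 2 (1 / (1 - I * s)) + polylog 2 (-(I * s) / (1 - I * s)) =
      (Real.pi : ℂ) ^ 2 / 6
        + log (1 - I * s) * (log s - I * (Real.pi / 2) - log (1 - I * s)) := by
  have key := eq_of_hasDerivAt_zero (b := s) h0
    (f := fun t : ℝ => polylog 2 (1 / (1 - I * t)) + polylog 2 (-(I * t) / (1 - I * t))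
      - log (1 - I * t) * log t
      + (log (1 - I * t) * (I * (Real.pi / 2)) + log (1 - I * t) ^ 2)) ?_ ?_
  · simp [polylog_zero_right, polylog_two_one] at key
    simp
    linear_combination key
  · have hl := continuous_log_one_sub_I_mul
    exact (((continuousOn_polylog le_rfl continuous_inv_one_sub_I_mul.continuousOn
        fun t ht => norm_inv_one_sub_I_mul_le t).add
      (continuousOn_polylog le_rfl continuous_neg_I_mul_div.continuousOn
        fun t ht => (norm_neg_I_mul_div_lt t).le)).sub
      (continuousOn_log_one_sub_I_mul_mul_log.mono (Icc_subset_Icc_right h1))).add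
      ((hl.mul continuous_const).add (hl.pow 2)).continuousOn
  · rintro t ⟨ht0, ht1⟩
    obtain ⟨hz, hs⟩ := ne_zero_and_mem_slitPlane ht0
    have hp := one_sub_I_mul_ne_zero t
    have hl := hasDerivAt_log_one_sub_I_mul t
    refine ((((hasDerivAt_polylog_two_inv ht0).add (hasDerivAt_polylog_two_neg_div ht0)).sub
      (hl.mul (hasDerivAt_log hs))).add ((hl.mul_const (I * (Real.pi / 2))).add
      (hl.pow 2))).comp_ofReal.congr_deriv ?_
    field_simp
    push_cast
    ring

lemma eulerSum_two_I_mul {s : ℝ} (h0 : 0 ≤ s) (h1 : s ≤ 1) :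
    polylog 3 (1 / (1 - I * s)) + log (1 - I * s) * polylog 2 (1 / (1 - I * s))
      + (eulerSum 2 (I * s) - polylog 3 (I * s)) - log (1 - I * s) ^ 2 * log s / 2
      + I * (Real.pi / 4) * log (1 - I * s) ^ 2 + log (1 - I * s) ^ 3 / 3 = zeta3 := by
  have key := eq_of_hasDerivAt_zero (b := s) h0
    (f := fun t : ℝ => polylog 3 (1 / (1 - I * t)) + log (1 - I * t) * polylog 2 (1 / (1 - I * t))
      + (eulerSum 2 (I * t) - polylog 3 (I * t)) - log (1 - I * t) * (log (1 - I * t) * log t) / 2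
      + I * (Real.pi / 4) * log (1 - I * t) ^ 2 + log (1 - I * t) ^ 3 / 3) ?_ ?_
  · simp [polylog_zero_right, polylog_three_one, eulerSum_zero_right] at key
    simp
    linear_combination key
  · have hl := continuous_log_one_sub_I_mul
    have hI : ∀ t ∈ Icc 0 s, ‖I * (t : ℂ)‖ ≤ 1 := fun t ht => norm_I_mul_le ⟨ht.1, ht.2.trans h1⟩
    exact (((((continuousOn_polylog (by norm_num) continuous_inv_one_sub_I_mul.continuousOn
        fun t ht => norm_inv_one_sub_I_mul_le t).add
      (hl.continuousOn.mul (continuousOn_polylog le_rfl continuous_inv_one_sub_I_mul.continuousOn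
        fun t ht => norm_inv_one_sub_I_mul_le t))).add
      ((continuousOn_eulerSum_two (by fun_prop) hI).sub
        (continuousOn_polylog (by norm_num) (by fun_prop) hI))).sub
      ((hl.continuousOn.mul
        (continuousOn_log_one_sub_I_mul_mul_log.mono (Icc_subset_Icc_right h1))).div_const 2)).add
      (continuous_const.mul (hl.pow 2)).continuousOn).add ((hl.pow 3).div_const 3).continuousOn
  · rintro t ⟨ht0, ht1⟩
    obtain ⟨hz, hs⟩ := ne_zero_and_mem_slitPlane ht0
    have hp := one_sub_I_mul_ne_zero t
    have hl := hasDerivAt_log_one_sub_I_mul t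
    refine ((((((hasDerivAt_polylog_three_inv ht0).add
      (hl.mul (hasDerivAt_polylog_two_inv ht0))).add
      (hasDerivAt_eulerSum_two_I_mul ht0 (ht1.trans_le h1))).sub
      ((hl.mul (hl.mul (hasDerivAt_log hs))).div_const 2)).add
      ((hl.pow 2).const_mul (I * (Real.pi / 4)))).add
      ((hl.pow 3).div_const 3)).comp_ofReal.congr_deriv ?_
    simp only [Pi.mul_apply]
    generalize polylog 2 (1 / (1 - I * t)) = q
    field_simp
    push_cast
    ring

/-- Landen's identity for the trilogarithm along the segment from `0` to `I`. -/
lemma polylog_three_landen {s : ℝ} (h0 : 0 ≤ s) (h1 : s ≤ 1) :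
    polylog 3 (1 / (1 - I * s)) + polylog 3 (-(I * s) / (1 - I * s)) + polylog 3 (I * s)
      + log (1 - I * s) ^ 2 * log s / 2 + (Real.pi : ℂ) ^ 2 / 6 * log (1 - I * s)
      - I * (Real.pi / 4) * log (1 - I * s) ^ 2 - log (1 - I * s) ^ 3 / 3 = zeta3 := by
  have key := eq_of_hasDerivAt_zero (b := s) h0
    (f := fun t : ℝ => polylog 3 (1 / (1 - I * t)) + polylog 3 (-(I * t) / (1 - I * t))
      + polylog 3 (I * t)
      + log (1 - I * t) * (log (1 - I * t) * log t) / 2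
      + (Real.pi : ℂ) ^ 2 / 6 * log (1 - I * t)
      - I * (Real.pi / 4) * log (1 - I * t) ^ 2 - log (1 - I * t) ^ 3 / 3) ?_ ?_
  · simp [polylog_zero_right, polylog_three_one] at key
    simp
    linear_combination key
  · have hl := continuous_log_one_sub_I_mul
    have hI : ∀ t ∈ Icc 0 s, ‖I * (t : ℂ)‖ ≤ 1 := fun t ht => norm_I_mul_le ⟨ht.1, ht.2.trans h1⟩
    exact ((((((continuousOn_polylog (by norm_num) continuous_inv_one_sub_I_mul.continuousOn
        fun t ht => norm_inv_one_sub_I_mul_le t).add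
      (continuousOn_polylog (by norm_num) continuous_neg_I_mul_div.continuousOn
        fun t ht => (norm_neg_I_mul_div_lt t).le)).add
      (continuousOn_polylog (by norm_num) (by fun_prop) hI)).add
      ((hl.continuousOn.mul
        (continuousOn_log_one_sub_I_mul_mul_log.mono (Icc_subset_Icc_right h1))).div_const 2)).add
      (continuous_const.mul hl).continuousOn).sub
      (continuous_const.mul (hl.pow 2)).continuousOn).sub ((hl.pow 3).div_const 3).continuousOn
  · rintro t ⟨ht0, ht1⟩
    obtain ⟨hz, hs⟩ := ne_zero_and_mem_slitPlane ht0
    have hp := one_sub_I_mul_ne_zero t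
    have hl := hasDerivAt_log_one_sub_I_mul t
    have hlt := ht1.trans_le h1
    have hQ := polylog_two_reflection ht0.le hlt.le
    have hS := polylog_two_landen ht0.le hlt.le
    refine (((((((hasDerivAt_polylog_three_inv ht0).add
      (hasDerivAt_polylog_three_neg_div ht0)).add
      (hasDerivAt_polylog_three_I_mul ht0 hlt)).add
      ((hl.mul (hl.mul (hasDerivAt_log hs))).div_const 2)).add
      (hl.const_mul ((Real.pi : ℂ) ^ 2 / 6))).sub
      ((hl.pow 2).const_mul (I * (Real.pi / 4)))).sub
      ((hl.pow 3).div_const 3)).comp_ofReal.congr_deriv ?_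
    simp only [Pi.mul_apply]
    rw [← eq_sub_iff_add_eq] at hQ
    rw [add_assoc, add_eq_zero_iff_eq_neg] at hS
    rw [hQ, hS]
    generalize polylog 2 (I * t) = u
    field_simp
    push_cast
    ring

/-! ### Special values -/

lemma psum_conj {c : ℕ → ℂ} (hc : ∀ n, (starRingEnd ℂ) (c n) = c n) (z : ℂ) :
    psum c ((starRingEnd ℂ) z) = (starRingEnd ℂ) (psum c z) := by
  unfold psum
  rw [conj_tsum]
  congr 1; ext n
  rw [map_mul, map_pow, hc]

lemma polylog_conj (s : ℕ) (z : ℂ) :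
    polylog s ((starRingEnd ℂ) z) = (starRingEnd ℂ) (polylog s z) :=
  psum_conj (fun n => by simp) z

lemma eulerSum_conj (s : ℕ) (z : ℂ) :
    eulerSum s ((starRingEnd ℂ) z) = (starRingEnd ℂ) (eulerSum s z) :=
  psum_conj (fun n => by simp) z

lemma hasSum_polylog {s : ℕ} (hs : 2 ≤ s) {z : ℂ} (hz : ‖z‖ ≤ 1) :
    HasSum (fun n : ℕ => 1 / (n + 1 : ℂ) ^ s * z ^ (n + 1)) (polylog s z) :=
  (summable_psum (summable_one_div_succ_pow hs) hz).hasSum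

lemma polylog_add_polylog_neg {s : ℕ} (hs : 2 ≤ s) {z : ℂ} (hz : ‖z‖ ≤ 1) :
    polylog s z + polylog s (-z) = 2 / 2 ^ s * polylog s (z ^ 2) := by
  have h := (hasSum_polylog hs hz).add (hasSum_polylog hs (z := -z) (by rwa [norm_neg]))
  have hz2 : ‖z ^ 2‖ ≤ 1 := by rw [norm_pow]; exact pow_le_one₀ (norm_nonneg _) hz
  refine h.unique ?_
  have he : HasSum (fun m : ℕ => 1 / (((2 * m : ℕ) : ℂ) + 1) ^ s * z ^ (2 * m + 1) +
      1 / (((2 * m : ℕ) : ℂ) + 1) ^ s * (-z) ^ (2 * m + 1)) 0 := by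
    refine hasSum_zero.congr_fun fun m => ?_
    rw [Odd.neg_pow ⟨m, rfl⟩]; ring
  have ho : HasSum (fun m : ℕ => 1 / (((2 * m + 1 : ℕ) : ℂ) + 1) ^ s * z ^ (2 * m + 1 + 1) +
      1 / (((2 * m + 1 : ℕ) : ℂ) + 1) ^ s * (-z) ^ (2 * m + 1 + 1))
      (2 / 2 ^ s * polylog s (z ^ 2)) := by
    refine ((hasSum_polylog hs hz2).mul_left (2 / 2 ^ s)).congr_fun fun m => ?_
    rw [Even.neg_pow ⟨m + 1, by ring⟩, ← pow_mul]
    have : ((2 * m + 1 : ℕ) : ℂ) + 1 = 2 * (m + 1) := by push_cast; ring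
    rw [this, mul_pow, mul_add, mul_one, add_assoc]
    field_simp
    norm_num
  simpa only [zero_add] using HasSum.even_add_odd
    (f := fun n : ℕ => 1 / (n + 1 : ℂ) ^ s * z ^ (n + 1) + 1 / (n + 1 : ℂ) ^ s * (-z) ^ (n + 1))
    he ho

lemma polylog_two_I_sub : polylog 2 I - polylog 2 (-I) = 2 * I * catalanG := by
  have h := (hasSum_polylog (s := 2) le_rfl (z := I) (by simp)).sub
    (hasSum_polylog (s := 2) le_rfl (z := -I) (by simp))
  have hI (m : ℕ) : I ^ (2 * m + 1) = (-1) ^ m * I := by rw [pow_succ, pow_mul, I_sq]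
  have heq (m : ℕ) : 1 / (((2 * m : ℕ) : ℂ) + 1) ^ 2 * I ^ (2 * m + 1) -
      1 / (((2 * m : ℕ) : ℂ) + 1) ^ 2 * (-I) ^ (2 * m + 1) =
      2 * I * (((-1) ^ m / (2 * m + 1 : ℝ) ^ 2 : ℝ) : ℂ) := by
    rw [Odd.neg_pow ⟨m, rfl⟩, hI]
    push_cast; ring
  have hsum := h.summable.comp_injective (i := fun m : ℕ => 2 * m)
    (fun a b hab => by simpa using hab)
  have he : HasSum (fun m : ℕ => 1 / (((2 * m : ℕ) : ℂ) + 1) ^ 2 * I ^ (2 * m + 1) -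
      1 / (((2 * m : ℕ) : ℂ) + 1) ^ 2 * (-I) ^ (2 * m + 1)) (2 * I * catalanG) := by
    unfold catalanG
    rw [ofReal_tsum, ← tsum_mul_left]
    simp only [← heq]
    exact hsum.hasSum
  have ho : HasSum (fun m : ℕ => 1 / (((2 * m + 1 : ℕ) : ℂ) + 1) ^ 2 * I ^ (2 * m + 1 + 1) -
      1 / (((2 * m + 1 : ℕ) : ℂ) + 1) ^ 2 * (-I) ^ (2 * m + 1 + 1)) 0 := by
    refine hasSum_zero.congr_fun fun m => ?_
    rw [Even.neg_pow ⟨m + 1, by ring⟩]; ring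
  refine h.unique ?_
  simpa only [add_zero] using HasSum.even_add_odd
    (f := fun n : ℕ => 1 / (n + 1 : ℂ) ^ 2 * I ^ (n + 1) - 1 / (n + 1 : ℂ) ^ 2 * (-I) ^ (n + 1))
    he ho

lemma polylog_two_neg_one : polylog 2 (-1) = -(Real.pi : ℂ) ^ 2 / 12 := by
  have h := polylog_add_polylog_neg (s := 2) le_rfl (z := 1) (by simp)
  rw [one_pow, polylog_two_one] at h
  linear_combination h

lemma polylog_three_neg_one : polylog 3 (-1) = -3 / 4 * (zeta3 : ℂ) := by
  have h := polylog_add_polylog_neg (s := 3) (by norm_num) (z := 1) (by simp)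
  rw [one_pow, polylog_three_one] at h
  linear_combination h

lemma polylog_two_I : polylog 2 I = -(Real.pi : ℂ) ^ 2 / 48 + I * catalanG := by
  have h := polylog_add_polylog_neg (s := 2) le_rfl (z := I) (by simp)
  rw [I_sq, polylog_two_neg_one] at h
  linear_combination h / 2 + polylog_two_I_sub / 2

lemma polylog_three_I_add : polylog 3 I + polylog 3 (-I) = -3 / 16 * (zeta3 : ℂ) := by
  have h := polylog_add_polylog_neg (s := 3) (by norm_num) (z := I) (by simp)
  rw [I_sq, polylog_three_neg_one] at h
  linear_combination h

lemma log_one_sub_I : log (1 - I) = (Real.log 2 : ℂ) / 2 - I * (Real.pi / 4) := by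
  have hs : Real.exp (Real.log 2 / 2) = √2 := by
    rw [Real.exp_half, Real.exp_log two_pos]
  have hz : (Real.log 2 : ℂ) / 2 - I * (Real.pi / 4)
      = ((Real.log 2 / 2 : ℝ) : ℂ) + ((-(Real.pi / 4) : ℝ) : ℂ) * I := by push_cast; ring
  have hre : ((Real.log 2 : ℂ) / 2 - I * (Real.pi / 4)).re = Real.log 2 / 2 := by
    rw [hz, add_re, ofReal_re, re_ofReal_mul, I_re, mul_zero, add_zero]
  have him : ((Real.log 2 : ℂ) / 2 - I * (Real.pi / 4)).im = -(Real.pi / 4) := by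
    rw [hz, add_im, ofReal_im, im_ofReal_mul, I_im, mul_one, zero_add]
  have h2 : √(2 : ℝ) * √2 = 2 := Real.mul_self_sqrt (by norm_num)
  have h : 1 - I = exp ((Real.log 2 : ℂ) / 2 - I * (Real.pi / 4)) := by
    apply Complex.ext
    · rw [exp_re, hre, him, hs, Real.cos_neg, Real.cos_pi_div_four]
      simp; linarith
    · rw [exp_im, hre, him, hs, Real.sin_neg, Real.sin_pi_div_four]
      simp; linarith
  rw [h, log_exp] <;> rw [him] <;> linarith [Real.pi_pos]

lemma inv_one_sub_I : 1 / (1 - I) = (1 + I) / 2 := by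
  have : 1 - I ≠ 0 := by simpa using one_sub_I_mul_ne_zero 1
  rw [div_eq_div_iff this two_ne_zero]
  linear_combination I_sq

lemma neg_I_div_one_sub_I : -I / (1 - I) = (1 - I) / 2 := by
  have : 1 - I ≠ 0 := by simpa using one_sub_I_mul_ne_zero 1
  rw [div_eq_div_iff this two_ne_zero]
  linear_combination -I_sq

lemma conj_half_one_sub_I : (starRingEnd ℂ) ((1 - I) / 2) = (1 + I) / 2 := by
  simp only [map_div₀, map_sub, map_one, conj_I, map_ofNat, sub_neg_eq_add]

lemma polylog_two_half_one_sub_I :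
    polylog 2 ((1 - I) / 2) = -((Real.log 2 : ℂ) / 2 - I * (Real.pi / 4)) ^ 2 / 2
      + (Real.pi : ℂ) ^ 2 / 48 - I * catalanG := by
  have h := polylog_two_landen zero_le_one le_rfl
  simp only [ofReal_one, mul_one, neg_I_div_one_sub_I, log_one_sub_I, polylog_two_I] at h
  linear_combination h

lemma polylog_two_half_one_add_I :
    polylog 2 ((1 + I) / 2) = -((Real.log 2 : ℂ) / 2 + I * (Real.pi / 4)) ^ 2 / 2
      + (Real.pi : ℂ) ^ 2 / 48 + I * catalanG := by
  rw [← conj_half_one_sub_I, polylog_conj, polylog_two_half_one_sub_I]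
  simp only [map_add, map_sub, map_neg, map_mul, map_div₀, map_pow, conj_ofReal, conj_I,
    map_ofNat]
  ring

/-- The sum of trilogarithms at `(1 ± I) / 2`. -/
lemma polylog_three_half_add :
    polylog 3 ((1 + I) / 2) + polylog 3 ((1 - I) / 2) =
      35 / 32 * (zeta3 : ℂ) - 5 * (Real.pi : ℂ) ^ 2 / 96 * (Real.log 2 : ℂ)
        + (Real.log 2 : ℂ) ^ 3 / 24 := by
  have h := polylog_three_landen zero_le_one le_rfl
  simp only [ofReal_one, mul_one, neg_I_div_one_sub_I, inv_one_sub_I, log_one_sub_I, log_one,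
    mul_zero, zero_div, add_zero] at h
  have h' := congrArg (starRingEnd ℂ) h
  simp only [map_add, map_sub, map_mul, map_div₀, map_pow, conj_ofReal, conj_I, map_ofNat,
    ← polylog_conj] at h'
  simp only [map_one, ← sub_eq_add_neg, sub_neg_eq_add] at h'
  linear_combination h / 2 + h' / 2 - polylog_three_I_add / 2
    - (Real.pi : ℂ) ^ 2 * Real.log 2 / 32 * I_sq

lemma eulerSum_two_I_add :
    eulerSum 2 I + eulerSum 2 (-I) = 23 / 32 * (zeta3 : ℂ) - Real.pi / 2 * catalanG := by
  have h := eulerSum_two_I_mul zero_le_one le_rfl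
  simp only [ofReal_one, mul_one, inv_one_sub_I, log_one_sub_I, log_one,
    mul_zero, zero_div, sub_zero, polylog_two_half_one_add_I] at h
  have h' := congrArg (starRingEnd ℂ) h
  simp only [map_add, map_sub, map_neg, map_mul, map_div₀, map_pow, conj_ofReal, conj_I, map_ofNat,
    ← polylog_conj, ← eulerSum_conj] at h'
  simp only [map_one, ← sub_eq_add_neg] at h'
  linear_combination h + h' + polylog_three_I_add - polylog_three_half_add
    + (Real.pi * catalanG / 2 + (Real.pi : ℂ) ^ 2 * Real.log 2 / 32) * I_sq

lemma special_value_combination :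
    4 * (polylog 3 (-1) + polylog 3 ((1 - I) / 2) + polylog 3 ((1 + I) / 2))
      - 2 * (eulerSum 2 (1 / 2) + eulerSum 2 I + eulerSum 2 (-I)) =
    ((-(33 * zeta3) / 16 + Real.pi * catalanG + Real.log 2 ^ 3 / 6 -
        Real.pi ^ 2 * Real.log 2 / 24 : ℝ) : ℂ) := by
  push_cast
  linear_combination 4 * polylog_three_neg_one + 4 * polylog_three_half_add
    - 2 * eulerSum_two_half - 2 * eulerSum_two_I_add

/-! ### Integrals -/

lemma integral_pow_mul_one_sub_pow (a b : ℕ) :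
    ∫ x in (0 : ℝ)..1, x ^ a * (1 - x) ^ b =
      (a.factorial * b.factorial : ℝ) / (a + b + 1).factorial := by
  induction b generalizing a with
  | zero =>
    have : (a.factorial : ℝ) ≠ 0 := by positivity
    have : (a + 1 : ℝ) ≠ 0 := by positivity
    simp [Nat.factorial_succ]
    field_simp
  | succ b ih =>
    have hd : ∀ x ∈ uIcc (0 : ℝ) 1, HasDerivAt (fun x : ℝ => x ^ (a + 1) * (1 - x) ^ (b + 1))
        ((a + 1) * (x ^ a * (1 - x) ^ (b + 1)) - (b + 1) * (x ^ (a + 1) * (1 - x) ^ b)) x := by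
      intro x _
      refine ((hasDerivAt_pow (a + 1) x).mul (((hasDerivAt_id x).const_sub 1).pow (b + 1))).congr_deriv ?_
      simp
      ring
    have h := intervalIntegral.integral_eq_sub_of_hasDerivAt hd
      (Continuous.intervalIntegrable (by fun_prop) _ _)
    rw [intervalIntegral.integral_sub (Continuous.intervalIntegrable (by fun_prop) _ _)
      (Continuous.intervalIntegrable (by fun_prop) _ _), intervalIntegral.integral_const_mul,
      intervalIntegral.integral_const_mul, ih (a + 1)] at h
    have h1 : (a + 1 : ℝ) ≠ 0 := by positivity
    have h2 : a + 1 + b + 1 = a + (b + 1) + 1 := by ring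
    rw [h2] at h
    simp only [sub_self, zero_pow b.succ_ne_zero, zero_pow a.succ_ne_zero, mul_zero, zero_mul] at h
    apply mul_left_cancel₀ h1
    rw [sub_eq_zero.1 h, Nat.factorial_succ a, Nat.factorial_succ b]
    push_cast
    ring

lemma intervalIntegrable_mul_log {q : ℝ → ℝ} (hq : Continuous q) :
    IntervalIntegrable (fun x => q x * Real.log x) volume 0 1 :=
  intervalIntegral.intervalIntegrable_log'.continuousOn_mul hq.continuousOn

lemma intervalIntegrable_log_one_sub :
    IntervalIntegrable (fun x => Real.log (1 - x)) volume 0 1 := by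
  have h := (intervalIntegral.intervalIntegrable_log' (a := 0) (b := 1)).comp_sub_left 1
  simpa using h.symm

lemma integral_pow_mul_log (n : ℕ) :
    ∫ x in (0 : ℝ)..1, x ^ n * Real.log x = -(1 / (n + 1 : ℝ) ^ 2) := by
  have hn : (n + 1 : ℝ) ≠ 0 := by positivity
  rw [intervalIntegral.integral_eq_sub_of_hasDerivAt_of_le zero_le_one
    (f := fun x : ℝ => x ^ n * (x * Real.log x) / (n + 1) - x ^ (n + 1) / (n + 1) ^ 2)]
  · simp
  · have := Real.continuous_mul_log
    exact Continuous.continuousOn (by fun_prop)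
  · intro x hx
    have hx0 : x ≠ 0 := hx.1.ne'
    have h1 : HasDerivAt (fun x : ℝ => x ^ (n + 1) * Real.log x / (n + 1) - x ^ (n + 1) / (n + 1) ^ 2)
        (x ^ n * Real.log x) x := by
      refine ((((hasDerivAt_pow (n + 1) x).mul (Real.hasDerivAt_log hx0)).div_const _).sub
        ((hasDerivAt_pow (n + 1) x).div_const _)).congr_deriv ?_
      simp only [Nat.add_sub_cancel]
      push_cast
      field_simp
      ring
    refine h1.congr_of_eventuallyEq (Eventually.of_forall fun y => ?_)
    simp only
    ring
  · exact intervalIntegrable_mul_log (by fun_prop)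

lemma integral_pow_mul_log_one_sub (n : ℕ) :
    ∫ x in (0 : ℝ)..1, x ^ n * Real.log (1 - x) = -((harmonic (n + 1) : ℝ) / (n + 1)) := by
  have hn : (n + 1 : ℝ) ≠ 0 := by positivity
  rw [intervalIntegral.integral_eq_sub_of_hasDerivAt_of_le zero_le_one
    (f := fun x : ℝ => -((∑ k ∈ Finset.range (n + 1), x ^ k) * ((1 - x) * Real.log (1 - x))) / (n + 1)
      - (∑ k ∈ Finset.range (n + 1), x ^ (k + 1) / (k + 1)) / (n + 1))]
  · simp [harmonic]
  · have h1 : Continuous fun x : ℝ => (1 - x) * Real.log (1 - x) :=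
      Real.continuous_mul_log.comp (continuous_const.sub continuous_id)
    exact Continuous.continuousOn (by fun_prop)
  · intro x hx
    have hx0 : 1 - x ≠ 0 := (sub_pos.2 hx.2).ne'
    have h1 : HasDerivAt (fun x : ℝ => (x ^ (n + 1) - 1) * Real.log (1 - x) / (n + 1)
        - (∑ k ∈ Finset.range (n + 1), x ^ (k + 1) / (k + 1)) / (n + 1))
        (x ^ n * Real.log (1 - x)) x := by
      have h2 : HasDerivAt (fun x : ℝ => ∑ k ∈ Finset.range (n + 1), x ^ (k + 1) / ((k : ℝ) + 1))
          (∑ k ∈ Finset.range (n + 1), x ^ k) x := by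
        refine HasDerivAt.fun_sum fun k _ => ?_
        refine ((hasDerivAt_pow (k + 1) x).div_const _).congr_deriv ?_
        have : (k + 1 : ℝ) ≠ 0 := by positivity
        simp only [Nat.add_sub_cancel]
        push_cast
        field_simp
      refine (((((hasDerivAt_pow (n + 1) x).sub_const 1).mul
        (((hasDerivAt_id x).const_sub 1).log hx0)).div_const _).sub
        (h2.div_const _)).congr_deriv ?_
      have h3 := geom_sum_mul x (n + 1)
      simp only [Nat.add_sub_cancel, id]
      rw [← h3]
      push_cast
      field_simp
      ring
    refine h1.congr_of_eventuallyEq (Eventually.of_forall fun y => ?_)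
    simp only
    rw [← geom_sum_mul y (n + 1)]
    ring
  · exact intervalIntegrable_log_one_sub.continuousOn_mul (by fun_prop)

lemma integral_eq_setIntegral_Ioo {E : Type*} [NormedAddCommGroup E] [NormedSpace ℝ E]
    (f : ℝ → E) : ∫ x in (0 : ℝ)..1, f x = ∫ x in Ioo (0 : ℝ) 1, f x := by
  rw [intervalIntegral.integral_of_le zero_le_one, integral_Ioc_eq_integral_Ioo]

lemma integrableOn_Ioo_of_intervalIntegrable {f : ℝ → ℝ}
    (h : IntervalIntegrable f volume 0 1) : IntegrableOn f (Ioo 0 1) :=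
  ((intervalIntegrable_iff_integrableOn_Ioc_of_le zero_le_one).1 h).mono_set Ioo_subset_Ioc_self

/-- Termwise integration of `∑ bₙ xⁿ` against a nonpositive weight with moments `-cₙ`. -/
lemma hasSum_integral_mul_pow {g : ℝ → ℝ} {c : ℕ → ℝ} (hg : IntervalIntegrable g volume 0 1)
    (hg0 : ∀ x ∈ Ioo (0 : ℝ) 1, g x ≤ 0)
    (hgc : ∀ n : ℕ, ∫ x in (0 : ℝ)..1, x ^ n * g x = -c n)
    {b : ℕ → ℂ} (hb : Summable fun n => ‖b n‖ * c n) :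
    HasSum (fun n => -(b n * c n)) (∫ x in Ioo (0 : ℝ) 1, ∑' n, b n * ((x ^ n * g x : ℝ) : ℂ)) := by
  have hint (n : ℕ) : IntegrableOn (fun x : ℝ => x ^ n * g x) (Ioo 0 1) :=
    integrableOn_Ioo_of_intervalIntegrable (hg.continuousOn_mul (by fun_prop))
  have h := hasSum_integral_of_summable_integral_norm (μ := volume.restrict (Ioo (0 : ℝ) 1))
    (F := fun n x => b n * ((x ^ n * g x : ℝ) : ℂ)) (fun n => (hint n).ofReal.const_mul _) ?_
  · refine h.congr_fun fun n => ?_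
    rw [integral_const_mul, integral_complex_ofReal, ← integral_eq_setIntegral_Ioo, hgc]
    push_cast; ring
  · refine hb.congr fun n => ?_
    have : ∫ x in Ioo (0 : ℝ) 1, ‖b n * ((x ^ n * g x : ℝ) : ℂ)‖ =
        ∫ x in Ioo (0 : ℝ) 1, -‖b n‖ * (x ^ n * g x) := by
      refine setIntegral_congr_fun measurableSet_Ioo fun x hx => ?_
      rw [norm_mul, Complex.norm_real, Real.norm_of_nonpos
        (mul_nonpos_of_nonneg_of_nonpos (pow_nonneg hx.1.le n) (hg0 x hx))]
      ring
    rw [this, integral_const_mul, ← integral_eq_setIntegral_Ioo, hgc]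
    ring

lemma norm_mul_ofReal_lt_one {a : ℂ} (ha : ‖a‖ ≤ 1) {x : ℝ} (hx : x ∈ Ioo (0 : ℝ) 1) :
    ‖a * (x : ℂ)‖ < 1 := by
  rw [norm_mul, Complex.norm_real, Real.norm_of_nonneg hx.1.le]
  exact (mul_le_of_le_one_left hx.1.le ha).trans_lt hx.2

lemma polylog_one_add_three {u : ℝ} {a : ℂ} (hu : |u| ≤ 1) (ha : ‖a‖ ≤ 1) {x : ℝ}
    (hx : x ∈ Ioo (0 : ℝ) 1) :
    polylog 1 (u * x) + polylog 1 (a * x) + polylog 1 ((starRingEnd ℂ) a * x) =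
      ((-Real.log ((1 - u * x) * normSq (1 - a * x)) : ℝ) : ℂ) := by
  have h1 := norm_mul_ofReal_lt_one ha hx
  have h3 : (starRingEnd ℂ) a * (x : ℂ) = (starRingEnd ℂ) (a * x) := by simp
  have hu' : ‖(u : ℂ)‖ ≤ 1 := by simpa using hu
  have h4 := norm_mul_ofReal_lt_one hu' hx
  have hs := one_sub_mem_slitPlane h1
  have hu0 : 0 < 1 - u * x := by
    have := one_sub_mem_slitPlane h4
    have h5 : (1 : ℂ) - u * x = ((1 - u * x : ℝ) : ℂ) := by push_cast; ring
    rw [h5, ofReal_mem_slitPlane] at this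
    exact this
  have hn : 0 < ‖1 - a * x‖ := norm_pos_iff.2 (slitPlane_ne_zero hs)
  rw [h3, polylog_conj, polylog_one h1, polylog_one h4,
    Real.log_mul hu0.ne' (normSq_pos.2 (slitPlane_ne_zero hs)).ne', normSq_eq_norm_sq, Real.log_pow,
    add_assoc, add_conj, neg_re, log_re]
  have h5 : (1 : ℂ) - u * x = ((1 - u * x : ℝ) : ℂ) := by push_cast; ring
  rw [h5, ← ofReal_log hu0.le]
  push_cast
  ring

/-- Integral of a product of logarithms against a weight with known moments. -/
lemma integral_mul_log_div {g : ℝ → ℝ} {c : ℕ → ℝ} (hg : IntervalIntegrable g volume 0 1)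
    (hg0 : ∀ x ∈ Ioo (0 : ℝ) 1, g x ≤ 0)
    (hgc : ∀ n : ℕ, ∫ x in (0 : ℝ)..1, x ^ n * g x = -c n)
    (hc0 : ∀ n, 0 ≤ c n) (hc : Summable fun n : ℕ => c n / (n + 1))
    {u : ℝ} {a : ℂ} (hu : |u| ≤ 1) (ha : ‖a‖ ≤ 1) :
    ((∫ x in (0 : ℝ)..1, g x * (-Real.log ((1 - u * x) * normSq (1 - a * x)) / x) : ℝ) : ℂ) =
      -(psum (fun n => (c n : ℂ) / (n + 1)) u + psum (fun n => (c n : ℂ) / (n + 1)) a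
        + psum (fun n => (c n : ℂ) / (n + 1)) ((starRingEnd ℂ) a)) := by
  set b : ℕ → ℂ := fun n =>
    ((u : ℂ) ^ (n + 1) + a ^ (n + 1) + (starRingEnd ℂ) a ^ (n + 1)) / (n + 1) with hb
  have hu' : ‖(u : ℂ)‖ ≤ 1 := by simpa using hu
  have ha' : ‖(starRingEnd ℂ) a‖ ≤ 1 := by simpa using ha
  have hsum : Summable fun n => ‖b n‖ * c n := by
    refine .of_nonneg_of_le (fun n => mul_nonneg (norm_nonneg _) (hc0 n)) (fun n => ?_)
      (hc.mul_left 3)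
    rw [hb]
    simp only
    rw [norm_div, norm_natCast_add_one, div_mul_eq_mul_div, ← mul_div_assoc]
    refine div_le_div_of_nonneg_right (mul_le_mul_of_nonneg_right ?_ (hc0 n)) (by positivity)
    refine (norm_add₃_le).trans ?_
    simp only [norm_pow]
    have := pow_le_one₀ (norm_nonneg _) hu' (n := n + 1)
    have := pow_le_one₀ (norm_nonneg _) ha (n := n + 1)
    have := pow_le_one₀ (norm_nonneg _) ha' (n := n + 1)
    linarith
  have h := hasSum_integral_mul_pow hg hg0 hgc hsum
  have hcn : Summable fun n : ℕ => ‖(c n : ℂ) / (n + 1)‖ := by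
    refine hc.congr fun n => ?_
    rw [norm_div, norm_natCast_add_one, Complex.norm_real, Real.norm_of_nonneg (hc0 n)]
  have h2 := (((summable_psum hcn hu').hasSum.add (summable_psum hcn ha).hasSum).add
    (summable_psum hcn ha').hasSum).neg
  have h3 := h.unique (h2.congr_fun fun n => by rw [hb]; ring)
  unfold psum
  rw [← h3, ← intervalIntegral.integral_ofReal, integral_eq_setIntegral_Ioo]
  refine setIntegral_congr_fun measurableSet_Ioo fun x hx => ?_
  have hx0 : (x : ℂ) ≠ 0 := by exact_mod_cast hx.1.ne'
  have h4 := (((hasSum_polylog_one (norm_mul_ofReal_lt_one hu' hx)).add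
    (hasSum_polylog_one (norm_mul_ofReal_lt_one ha hx))).add
    (hasSum_polylog_one (norm_mul_ofReal_lt_one ha' hx)))
  rw [← polylog_one (norm_mul_ofReal_lt_one hu' hx), ← polylog_one (norm_mul_ofReal_lt_one ha hx),
    ← polylog_one (norm_mul_ofReal_lt_one ha' hx), polylog_one_add_three hu ha hx] at h4
  have h5 := (h4.mul_left ((g x : ℂ) / x)).tsum_eq
  rw [ofReal_mul, ofReal_div, mul_div_assoc', mul_div_right_comm, ← h5]
  congr 1; ext n
  rw [hb]
  simp only
  push_cast
  rw [mul_pow, mul_pow, mul_pow, pow_succ (x : ℂ)]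
  field_simp

/-- The generating polynomial `x² (1 - x) / 2` of the series. -/
noncomputable def betaArg (x : ℝ) : ℝ := x ^ 2 * (1 - x) / 2

lemma continuous_betaArg : Continuous betaArg := by unfold betaArg; fun_prop

lemma betaArg_pos {x : ℝ} (hx : x ∈ Ioo (0 : ℝ) 1) : 0 < betaArg x :=
  div_pos (mul_pos (pow_pos hx.1 2) (sub_pos.2 hx.2)) two_pos

lemma betaArg_le_half {x : ℝ} (hx : x ∈ Ioo (0 : ℝ) 1) : betaArg x ≤ 1 / 2 := by
  have h1 : x ^ 2 * (1 - x) ≤ 1 :=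
    mul_le_one₀ (pow_le_one₀ hx.1.le hx.2.le) (sub_pos.2 hx.2).le (by linarith [hx.1])
  unfold betaArg
  linarith

lemma hasDerivAt_betaArg (x : ℝ) : HasDerivAt betaArg (x * (1 - x) - x ^ 2 / 2) x := by
  refine (((hasDerivAt_pow 2 x).mul ((hasDerivAt_id x).const_sub 1)).div_const 2).congr_deriv ?_
  simp
  ring

lemma one_div_cube_mul_choose (n : ℕ) :
    1 / ((n + 1 : ℝ) ^ 3 * 2 ^ (n + 1) * (Nat.choose (3 * (n + 1)) (n + 1) : ℝ)) =
      2 / (n + 1 : ℝ) ^ 2 * ∫ x in (0 : ℝ)..1, x * (1 - x) / 2 * betaArg x ^ n := by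
  have h1 (x : ℝ) : x * (1 - x) / 2 * betaArg x ^ n =
      (1 / 2 ^ (n + 1)) * (x ^ (2 * n + 1) * (1 - x) ^ (n + 1)) := by
    unfold betaArg
    rw [div_pow, mul_pow, ← pow_mul]
    field_simp
    ring
  simp only [h1]
  rw [intervalIntegral.integral_const_mul, integral_pow_mul_one_sub_pow,
    Nat.choose_eq_factorial_div_factorial (by omega), Nat.cast_div
      (Nat.factorial_mul_factorial_dvd_factorial (by omega)) (by positivity)]
  have h2 : 3 * (n + 1) - (n + 1) = (2 * n + 1) + 1 := by omega
  have h3 : 2 * n + 1 + (n + 1) + 1 = 3 * (n + 1) := by omega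
  rw [h2, h3, Nat.factorial_succ (2 * n + 1)]
  have : ((2 * n + 1).factorial : ℝ) ≠ 0 := by positivity
  have : ((n + 1).factorial : ℝ) ≠ 0 := by positivity
  have : ((3 * (n + 1)).factorial : ℝ) ≠ 0 := by positivity
  have : (n + 1 : ℝ) ≠ 0 := by positivity
  push_cast
  field_simp
  ring

lemma integral_log_mul_betaArg (n : ℕ) :
    (∫ x in (0 : ℝ)..1, x * (1 - x) / 2 * betaArg x ^ n) =
      -(n + 1) * ∫ x in (0 : ℝ)..1, (betaArg x ^ n * (x * (1 - x) - x ^ 2 / 2)) * Real.log x := by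
  have hb := continuous_betaArg
  have hi : IntervalIntegrable
      (fun x => (betaArg x ^ n * (x * (1 - x) - x ^ 2 / 2)) * Real.log x) volume 0 1 :=
    intervalIntegrable_mul_log (by fun_prop)
  have h := intervalIntegral.integral_eq_sub_of_hasDerivAt_of_le zero_le_one
    (f := fun x : ℝ => betaArg x ^ n * (x * (1 - x) / 2) * (x * Real.log x))
    (f' := fun x => x * (1 - x) / 2 * betaArg x ^ n +
      (n + 1) * ((betaArg x ^ n * (x * (1 - x) - x ^ 2 / 2)) * Real.log x)) ?_ ?_
    ((Continuous.intervalIntegrable (by fun_prop) _ _).add (hi.const_mul _))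
  · rw [intervalIntegral.integral_add (Continuous.intervalIntegrable (by fun_prop) _ _)
      (hi.const_mul _), intervalIntegral.integral_const_mul] at h
    simp only [Real.log_one, mul_zero, Real.log_zero, sub_zero] at h
    linear_combination h
  · have := Real.continuous_mul_log
    exact Continuous.continuousOn (by fun_prop)
  · intro x hx
    have hx0 : x ≠ 0 := hx.1.ne'
    have h1 := ((hasDerivAt_betaArg x).pow (n + 1)).mul (Real.hasDerivAt_log hx0)
    refine (h1.congr_of_eventuallyEq (Eventually.of_forall fun y => ?_)).congr_deriv ?_
    · simp only [Pi.mul_apply, Pi.pow_apply, pow_succ]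
      unfold betaArg
      ring
    · simp only [Pi.pow_apply, Nat.add_sub_cancel, pow_succ]
      push_cast
      have : betaArg x * x⁻¹ = x * (1 - x) / 2 := by
        unfold betaArg
        field_simp
      rw [mul_assoc _ (betaArg x), this]
      ring

/-- Termwise integration of `-log (1 - betaArg) / betaArg` against a continuous multiple of `log`. -/
lemma hasSum_integral_betaArg {q : ℝ → ℝ} (hq : Continuous q) :
    HasSum (fun n : ℕ => 1 / (n + 1 : ℝ) * ∫ x in (0 : ℝ)..1, (betaArg x ^ n * q x) * Real.log x)
      (∫ x in (0 : ℝ)..1, -Real.log (1 - betaArg x) / betaArg x * q x * Real.log x) := by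
  have hb := continuous_betaArg
  have hint (n : ℕ) : IntegrableOn (fun x => (betaArg x ^ n * q x) * Real.log x) (Ioo 0 1) :=
    integrableOn_Ioo_of_intervalIntegrable (intervalIntegrable_mul_log (by fun_prop))
  have hq' : IntegrableOn (fun x => q x * Real.log x) (Ioo 0 1) :=
    integrableOn_Ioo_of_intervalIntegrable (intervalIntegrable_mul_log hq)
  have h := hasSum_integral_of_summable_integral_norm (μ := volume.restrict (Ioo (0 : ℝ) 1))
    (F := fun (n : ℕ) x => 1 / (n + 1 : ℝ) * ((betaArg x ^ n * q x) * Real.log x))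
    (fun n => (hint n).const_mul _) ?_
  · suffices hs : (∫ x in (0 : ℝ)..1, -Real.log (1 - betaArg x) / betaArg x * q x * Real.log x) =
        ∫ x in Ioo (0 : ℝ) 1, ∑' n : ℕ, 1 / (n + 1 : ℝ) * ((betaArg x ^ n * q x) * Real.log x) by
      rw [hs]
      exact h.congr_fun fun n => by rw [integral_eq_setIntegral_Ioo, integral_const_mul]
    rw [integral_eq_setIntegral_Ioo]
    refine setIntegral_congr_fun measurableSet_Ioo fun x hx => ?_
    have hx0 := betaArg_pos hx
    have h1 := Real.hasSum_pow_div_log_of_abs_lt_one (x := betaArg x)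
      (by rw [abs_of_pos hx0]; linarith [betaArg_le_half hx])
    have h2 := (h1.mul_left (q x * Real.log x / betaArg x)).tsum_eq
    have h3 : -Real.log (1 - betaArg x) / betaArg x * q x * Real.log x =
      q x * Real.log x / betaArg x * -Real.log (1 - betaArg x) := by ring
    rw [h3, ← h2]
    congr 1; ext n
    rw [pow_succ]
    field_simp
  · refine .of_nonneg_of_le (fun n => integral_nonneg fun x => norm_nonneg _) (fun n => ?_)
      (summable_geometric_two.mul_right (∫ x in Ioo (0 : ℝ) 1, ‖q x * Real.log x‖))
    rw [← integral_const_mul]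
    refine setIntegral_mono_on ((hint n).const_mul _).norm (hq'.norm.const_mul _)
      measurableSet_Ioo fun x hx => ?_
    rw [mul_assoc (betaArg x ^ n), norm_mul, norm_mul, ← mul_assoc]
    refine mul_le_mul_of_nonneg_right ?_ (norm_nonneg _)
    rw [norm_pow, Real.norm_of_nonneg (betaArg_pos hx).le, Real.norm_of_nonneg (by positivity)]
    have h1 : 1 / (n + 1 : ℝ) ≤ 1 := by
      rw [div_le_one (by positivity)]
      linarith [n.cast_nonneg (α := ℝ)]
    calc 1 / (n + 1 : ℝ) * betaArg x ^ n ≤ 1 * (1 / 2) ^ n :=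
          mul_le_mul h1 (pow_le_pow_left₀ (betaArg_pos hx).le (betaArg_le_half hx) n)
            (pow_nonneg (betaArg_pos hx).le n) zero_le_one
      _ = _ := one_mul _

lemma one_sub_betaArg (x : ℝ) :
    1 - betaArg x = (1 - (-1 : ℝ) * x) * normSq (1 - (1 - I) / 2 * x) := by
  unfold betaArg
  have h : (1 : ℂ) - (1 - I) / 2 * x = ((1 - x / 2 : ℝ) : ℂ) + ((x / 2 : ℝ) : ℂ) * I := by
    push_cast; ring
  rw [h, normSq_add_mul_I]
  ring

lemma one_sub_betaArg_one_sub (x : ℝ) :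
    1 - betaArg (1 - x) = (1 - (1 / 2 : ℝ) * x) * normSq (1 - I * x) := by
  unfold betaArg
  have h : (1 : ℂ) - I * x = ((1 : ℝ) : ℂ) + ((-x : ℝ) : ℂ) * I := by
    push_cast; ring
  rw [h, normSq_add_mul_I]
  ring

lemma integral_log_mul_log_one_sub_betaArg :
    ((∫ x in (0 : ℝ)..1, -Real.log (1 - betaArg x) / betaArg x * (x * (1 - x)) * Real.log x : ℝ) : ℂ)
      = -2 * (polylog 3 (-1) + polylog 3 ((1 - I) / 2) + polylog 3 ((1 + I) / 2)) := by
  have hc : Summable fun n : ℕ => (1 / (n + 1 : ℝ) ^ 2) / (n + 1) := by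
    have := (summable_nat_add_iff 1).2 (Real.summable_one_div_nat_pow.2 (by norm_num : 1 < 3))
    refine this.congr fun n => ?_
    push_cast
    field_simp
  have ha : ‖(1 - I) / 2‖ ≤ 1 := by
    rw [norm_div, RCLike.norm_ofNat, div_le_one two_pos]
    refine (norm_sub_le _ _).trans ?_
    norm_num
  have h := integral_mul_log_div (g := Real.log) (c := fun n : ℕ => 1 / (n + 1 : ℝ) ^ 2)
    intervalIntegral.intervalIntegrable_log'
    (fun x hx => Real.log_nonpos hx.1.le hx.2.le) integral_pow_mul_log
    (fun n => by positivity) hc (u := -1) (a := (1 - I) / 2) (by simp) ha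
  have hp : (fun n : ℕ => ((1 / (n + 1 : ℝ) ^ 2 : ℝ) : ℂ) / (n + 1)) = fun n : ℕ => 1 / (n + 1 : ℂ) ^ 3 := by
    ext n
    have : (n + 1 : ℂ) ≠ 0 := Nat.cast_add_one_ne_zero n
    push_cast
    field_simp
  rw [hp, conj_half_one_sub_I] at h
  have h1 : ∫ x in (0 : ℝ)..1, -Real.log (1 - betaArg x) / betaArg x * (x * (1 - x)) * Real.log x =
      2 * ∫ x in (0 : ℝ)..1, Real.log x *
        (-Real.log ((1 - (-1 : ℝ) * x) * normSq (1 - (1 - I) / 2 * x)) / x) := by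
    rw [← intervalIntegral.integral_const_mul, integral_eq_setIntegral_Ioo,
      integral_eq_setIntegral_Ioo]
    refine setIntegral_congr_fun measurableSet_Ioo fun x hx => ?_
    have hx0 : x ≠ 0 := hx.1.ne'
    have hx1 : 1 - x ≠ 0 := (sub_pos.2 hx.2).ne'
    simp only [← one_sub_betaArg]
    generalize Real.log (1 - betaArg x) = L
    unfold betaArg
    field_simp
  rw [h1, ofReal_mul, h]
  unfold polylog
  push_cast
  ring

lemma integral_log_one_sub_mul_log_one_sub_betaArg :
    ((∫ x in (0 : ℝ)..1, -Real.log (1 - betaArg x) / betaArg x * (x ^ 2 / 2) * Real.log x : ℝ) : ℂ)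
      = -(eulerSum 2 (1 / 2) + eulerSum 2 I + eulerSum 2 (-I)) := by
  have hc : Summable fun n : ℕ => ((harmonic (n + 1) : ℝ) / (n + 1)) / (n + 1) := by
    refine summable_harmonic_div_sq.congr fun n => ?_
    field_simp
  have h := integral_mul_log_div (g := fun x => Real.log (1 - x))
    (c := fun n : ℕ => (harmonic (n + 1) : ℝ) / (n + 1)) intervalIntegrable_log_one_sub
    (fun x hx => Real.log_nonpos (sub_pos.2 hx.2).le (by linarith [hx.1]))
    integral_pow_mul_log_one_sub
    (fun n => div_nonneg (harmonic_nonneg _) (by positivity)) hc (u := 1 / 2) (a := I)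
    (by rw [abs_of_pos] <;> norm_num) norm_I.le
  have hp : (fun n : ℕ => (((harmonic (n + 1) : ℝ) / (n + 1) : ℝ) : ℂ) / (n + 1)) =
      fun n : ℕ => ((harmonic (n + 1) : ℝ) : ℂ) / (n + 1 : ℂ) ^ 2 := by
    ext n
    push_cast
    rw [div_div, sq]
  rw [hp, conj_I] at h
  have h1 : ∫ x in (0 : ℝ)..1, -Real.log (1 - betaArg x) / betaArg x * (x ^ 2 / 2) * Real.log x =
      ∫ x in (0 : ℝ)..1, Real.log (1 - x) *
        (-Real.log ((1 - (1 / 2 : ℝ) * x) * normSq (1 - I * x)) / x) := by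
    have h2 := intervalIntegral.integral_comp_sub_left (a := 0) (b := 1)
      (fun x => -Real.log (1 - betaArg x) / betaArg x * (x ^ 2 / 2) * Real.log x) (1 : ℝ)
    rw [sub_self, sub_zero] at h2
    rw [← h2, integral_eq_setIntegral_Ioo, integral_eq_setIntegral_Ioo]
    refine setIntegral_congr_fun measurableSet_Ioo fun x hx => ?_
    have hx0 : x ≠ 0 := hx.1.ne'
    have hx1 : 1 - x ≠ 0 := (sub_pos.2 hx.2).ne'
    simp only [← one_sub_betaArg_one_sub]
    generalize Real.log (1 - betaArg (1 - x)) = L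
    unfold betaArg
    rw [sub_sub_cancel]
    field_simp
  rw [h1, h]
  unfold eulerSum
  push_cast
  ring

lemma hasSum_one_div_cube_mul_choose :
    HasSum (fun n : ℕ =>
      1 / ((n + 1 : ℝ) ^ 3 * 2 ^ (n + 1) * (Nat.choose (3 * (n + 1)) (n + 1) : ℝ)))
      (-2 * ((∫ x in (0 : ℝ)..1,
          -Real.log (1 - betaArg x) / betaArg x * (x * (1 - x)) * Real.log x) -
        ∫ x in (0 : ℝ)..1, -Real.log (1 - betaArg x) / betaArg x * (x ^ 2 / 2) * Real.log x)) := by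
  have hb := continuous_betaArg
  refine (((hasSum_integral_betaArg (q := fun x => x * (1 - x)) (by fun_prop)).sub
    (hasSum_integral_betaArg (q := fun x => x ^ 2 / 2) (by fun_prop))).mul_left (-2)).congr_fun
    fun n => ?_
  have h1 : (n + 1 : ℝ) ≠ 0 := by positivity
  rw [one_div_cube_mul_choose, integral_log_mul_betaArg, ← mul_sub,
    ← intervalIntegral.integral_sub (intervalIntegrable_mul_log (by fun_prop))
      (intervalIntegrable_mul_log (by fun_prop))]
  simp only [← sub_mul, ← mul_sub]
  field_simp

end Auxiliary

theorem sun_inv3k_three :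
    ∑' k : ℕ, 1 / ((k + 1 : ℝ) ^ 3 * 2 ^ (k + 1) * (Nat.choose (3 * (k + 1)) (k + 1) : ℝ)) =
      -(33 * zeta3) / 16 + Real.pi * catalanG + Real.log 2 ^ 3 / 6 -
        Real.pi ^ 2 * Real.log 2 / 24 := by
  rw [hasSum_one_div_cube_mul_choose.tsum_eq]
  apply Complex.ofReal_injective
  rw [← special_value_combination, Complex.ofReal_mul, Complex.ofReal_sub,
    integral_log_mul_log_one_sub_betaArg, integral_log_one_sub_mul_log_one_sub_betaArg]
  push_cast
  ring
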